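/- Uniqueness Theorem: If the center is not helpless and the truthful profile (s^t,…,s^t) is an equilibrium of the competitive protocol F^c, then (s^t,…,s^t) is the only equilibrium of F^c. -/

import Mathlib

open scoped Classical
noncomputable section

/-- A strategy of an agent: `(p, q)` with `p = P(mᵢ = 0 ∣ bᵢ = 0)`, `q = P(mᵢ = 0 ∣ bᵢ = 1)`. -/
abbrev Strategy : Type := (Set.Icc (0:ℝ) 1) × (Set.Icc (0:ℝ) 1)

/-- The truthful strategy `sᵗ = (1,0)`. -/
def sT : Strategy := (⟨1, by norm_num⟩, ⟨0, by norm_num⟩)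

/-- A zero-information strategy: `p = q`. -/
def ZeroInfo (s : Strategy) : Prop := (s.1 : ℝ) = (s.2 : ℝ)

/-- Vectors of `N+1` bits (bits of the center and the `N` agents; also used for
message vectors and for the center's replies).  Coordinate `0` is the center. -/
abbrev Bits (N : ℕ) : Type := Fin (N+1) → Bool

/-- A strategy profile of the `N` agents. -/
abbrev Profile (N : ℕ) : Type := Fin N → Strategy

/-- A protocol for a single agent: a map from strategy profiles and message vectors to
distributions over replies `f ∈ {0,1}^{N+1}`. -/
abbrev Protocol (N : ℕ) : Type := Profile N → Bits N → PMF (Bits N)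

/-- `P(message = msg ∣ bit = bit)` under strategy `s` (where `false` plays the role of `0`). -/
def strandP (s : Strategy) (bit msg : Bool) : ℝ :=
  if msg then 1 - (if bit then (s.2 : ℝ) else (s.1 : ℝ))
  else (if bit then (s.2 : ℝ) else (s.1 : ℝ))

/-- `P(messages = m ∣ bits = b)` under profile `s`; the center's message is her own bit. -/
def msgP {N : ℕ} (s : Profile N) (b m : Bits N) : ℝ :=
  (if m 0 = b 0 then (1:ℝ) else 0) * ∏ i : Fin N, strandP (s i) (b i.succ) (m i.succ)

/-- Joint probability of bits `b`, messages `m` and reply `f` (to the relevant agent),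
under profile `s` and protocol `F`; bits are i.i.d. uniform. -/
def jointP {N : ℕ} (s : Profile N) (F : Protocol N) (b m f : Bits N) : ℝ :=
  ((1:ℝ)/2)^(N+1) * msgP s b m * ((F s m) f).toReal

/-- `P(bᵢ = bi, mᵢ = mi, fᵢ = f, g(b) = val)` for agent `i` (coordinate `i.succ`). -/
def pObs {N : ℕ} (g : Bits N → Bool) (s : Profile N) (F : Protocol N) (i : Fin N)
    (bi mi : Bool) (f : Bits N) (val : Bool) : ℝ :=
  ∑ b : Bits N, ∑ m : Bits N,
    if b i.succ = bi ∧ m i.succ = mi ∧ g b = val then jointP s F b m f else 0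

/-- `P(bᵢ = bi, mᵢ = mi, fᵢ = f)` for agent `i`. -/
def pObsAll {N : ℕ} (s : Profile N) (F : Protocol N) (i : Fin N)
    (bi mi : Bool) (f : Bits N) : ℝ :=
  ∑ b : Bits N, ∑ m : Bits N,
    if b i.succ = bi ∧ m i.succ = mi then jointP s F b m f else 0

/-- `P(b_k = 1, bᵢ = bi, mᵢ = mi, fᵢ = f)` for agent `i`. -/
def pBit {N : ℕ} (s : Profile N) (F : Protocol N) (i : Fin N)
    (bi mi : Bool) (f : Bits N) (k : Fin (N+1)) : ℝ :=
  ∑ b : Bits N, ∑ m : Bits N,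
    if b i.succ = bi ∧ m i.succ = mi ∧ b k = true then jointP s F b m f else 0

/-- The posterior `v_k = P(b_k = 1 ∣ fᵢ, mᵢ, bᵢ)` of agent `i` at the realization
`(bi, mi, f)`. -/
def post {N : ℕ} (s : Profile N) (F : Protocol N) (i : Fin N)
    (bi mi : Bool) (f : Bits N) (k : Fin (N+1)) : ℝ :=
  pBit s F i bi mi f k / pObsAll s F i bi mi f

/-- Expected profit `V_i(s⃗; F_i)`: after observing `(bᵢ, mᵢ, fᵢ)` the agent guesses the
more likely value of `g(b)` (uniformly at random in case of a tie) and earns `c i` iff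
the guess is correct. -/
def V {N : ℕ} (g : Bits N → Bool) (c : Fin N → ℝ) (s : Profile N) (F : Protocol N)
    (i : Fin N) : ℝ :=
  c i * ∑ bi : Bool, ∑ mi : Bool, ∑ f : Bits N,
    (if pObs g s F i bi mi f true > pObs g s F i bi mi f false then pObs g s F i bi mi f true
     else if pObs g s F i bi mi f false > pObs g s F i bi mi f true then
       pObs g s F i bi mi f false
     else (pObs g s F i bi mi f false + pObs g s F i bi mi f true) / 2)

/-- Utility `U_i(s⃗; F_i) = V_i(s⃗; F_i) − priceᵢ(sᵢ)`. -/
def U {N : ℕ} (g : Bits N → Bool) (c : Fin N → ℝ) (price : Fin N → Strategy → ℝ)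
    (s : Profile N) (F : Protocol N) (i : Fin N) : ℝ :=
  V g c s F i - price i (s i)

/-- The all-truthful profile `(sᵗ, …, sᵗ)`. -/
def truthProfile (N : ℕ) : Profile N := fun _ => sT

/-- `s⃗` is an equilibrium of the protocol `F = (F_1,…,F_N)`. -/
def Equilibrium {N : ℕ} (g : Bits N → Bool) (c : Fin N → ℝ) (price : Fin N → Strategy → ℝ)
    (s : Profile N) (FF : Fin N → Protocol N) : Prop :=
  ∀ i : Fin N, ∀ s' : Strategy,
    U g c price s (FF i) i ≥ U g c price (Function.update s i s') (FF i) i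

/-- The improvement `F_i⁺` of a protocol `F_i`: it agrees with `F_i` when `s_i` is a
zero-information strategy, and otherwise returns the reply whose first coordinate is
`m₀ = b₀` and whose remaining coordinates are those of `F_i`'s reply. -/
def improve {N : ℕ} (i : Fin N) (F : Protocol N) : Protocol N := fun s m =>
  if ZeroInfo (s i) then F s m
  else PMF.map (fun f => Function.update f 0 (m 0)) (F s m)

/-- The center is helpless. -/
def Helpless (N : ℕ) (g : Bits N → Bool) (c : Fin N → ℝ)
    (price : Fin N → Strategy → ℝ) : Prop :=
  ∀ i : Fin N, ∀ F : Protocol N, ∀ si : Strategy, ¬ ZeroInfo si →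
    ∀ sr : Profile N, (∀ j, ZeroInfo (sr j)) →
      U g c price sr F i ≥ U g c price (Function.update sr i si) (improve i F) i

/-- Relative price `price_i^r(s_i) = price_i(s_i) / price_i(sᵗ)`. -/
def priceR {N : ℕ} (price : Fin N → Strategy → ℝ) (i : Fin N) (s : Strategy) : ℝ :=
  price i s / price i sT

/-- The competitive protocol (the component `F_i^c` for agent `i`). -/
def Fc {N : ℕ} (price : Fin N → Strategy → ℝ) (i : Fin N) : Protocol N := fun s m =>
  if ∀ j, s j = sT then PMF.pure m
  else if ∀ j, j ≠ i → priceR price j (s j) < priceR price i (s i) then PMF.pure m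
  else PMF.uniformOfFintype (Bits N)

/-- The protocol that always replies the full message vector `m = (b₀, m₁, …, m_N)`. -/
def Fmax (N : ℕ) : Protocol N := fun _ m => PMF.pure m

/-- The protocol that always replies `N+1` independent uniform random bits. -/
def Fmin (N : ℕ) : Protocol N := fun _ _ => PMF.uniformOfFintype (Bits N)

/-- Agent `i` is fanatic. -/
def Fanatic {N : ℕ} (g : Bits N → Bool) (c : Fin N → ℝ) (price : Fin N → Strategy → ℝ)
    (i : Fin N) : Prop :=
  ∀ s : Profile N,
    price i sT > V g c (truthProfile N) (Fmax N) i - V g c s (Fmin N) i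

/-- The fair competitive protocol (the component `F_i^{fc}` for agent `i`). -/
def Ffc {N : ℕ} (price : Fin N → Strategy → ℝ) (i : Fin N) : Protocol N := fun s m =>
  if s i = sT then PMF.pure m
  else if (∃ j, j ≠ i ∧ s j ≠ sT) ∧
      (∀ j, j ≠ i → s j ≠ sT → priceR price j (s j) < priceR price i (s i)) then PMF.pure m
  else PMF.uniformOfFintype (Bits N)

/-- Up to normalization, the probability that the best guess of `g b` is correct when `b` is
uniform and an observation is drawn with likelihood `L b`. -/
def guessValue {B O : Type*} [Fintype B] [Fintype O] (g : B → Bool) (L : B → O → ℝ) : ℝ :=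
  ∑ o, max (∑ b, if g b = true then L b o else 0) (∑ b, if g b = false then L b o else 0)

/-- The likelihood of observing exactly `κ b`. -/
def revealing {B K : Type*} (κ : B → K) (b : B) (k : K) : ℝ := if κ b = k then 1 else 0

/-- An observation whose likelihood depends on `b` only through `κ b` is worth at most `κ b`. -/
lemma guessValue_le_revealing {B O K : Type*} [Fintype B] [Fintype O] [Fintype K]
    (g : B → Bool) (L : B → O → ℝ) (hL : ∀ b o, 0 ≤ L b o) (hsum : ∀ b, ∑ o, L b o = 1)
    (κ : B → K) (σ : K → B) (hσ : ∀ b o, L b o = L (σ (κ b)) o) :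
    guessValue g L ≤ guessValue g (revealing κ) := by
  have key : ∀ o v, (∑ b, if g b = v then L b o else 0)
      = ∑ k, L (σ k) o * ∑ b, if g b = v then revealing κ b k else 0 := by
    intro o v
    simp_rw [Finset.mul_sum]
    rw [Finset.sum_comm]
    refine Finset.sum_congr rfl fun b _ => ?_
    by_cases h : g b = v
    · simp [h, revealing, ← hσ b o]
    · simp [h]
  have hmax : ∀ k, (∑ o, L (σ k) o * max (∑ b, if g b = true then revealing κ b k else 0)
      (∑ b, if g b = false then revealing κ b k else 0))
      = max (∑ b, if g b = true then revealing κ b k else 0)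
      (∑ b, if g b = false then revealing κ b k else 0) := by
    intro k
    rw [← Finset.sum_mul, hsum, one_mul]
  unfold guessValue
  rw [← Finset.sum_congr rfl fun k _ => hmax k, Finset.sum_comm]
  refine Finset.sum_le_sum fun o _ => max_le ?_ ?_ <;> rw [key]
  · exact Finset.sum_le_sum fun k _ => mul_le_mul_of_nonneg_left (le_max_left _ _) (hL _ _)
  · exact Finset.sum_le_sum fun k _ => mul_le_mul_of_nonneg_left (le_max_right _ _) (hL _ _)

/-- An observation from which `κ b` can be recovered is worth at least `κ b`. -/
lemma revealing_le_guessValue {B O K : Type*} [Fintype B] [Fintype O] [Fintype K]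
    (g : B → Bool) (L : B → O → ℝ) (hsum : ∀ b, ∑ o, L b o = 1)
    (κ : B → K) (ψ : O → K) (hψ : ∀ b o, L b o ≠ 0 → ψ o = κ b) :
    guessValue g (revealing κ) ≤ guessValue g L := by
  have key : ∀ k v, (∑ b, if g b = v then revealing κ b k else 0)
      = ∑ o, if ψ o = k then (∑ b, if g b = v then L b o else 0) else 0 := by
    intro k v
    have h1 : ∀ o, (if ψ o = k then (∑ b, if g b = v then L b o else 0) else 0)
        = ∑ b, if g b = v then (if κ b = k then L b o else 0) else 0 := by
      intro o
      by_cases ho : ψ o = k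
      · rw [if_pos ho]
        refine Finset.sum_congr rfl fun b _ => ?_
        have := hψ b o
        grind
      · rw [if_neg ho]
        refine (Finset.sum_eq_zero fun b _ => ?_).symm
        have := hψ b o
        grind
    simp_rw [h1]
    rw [Finset.sum_comm]
    refine Finset.sum_congr rfl fun b _ => ?_
    by_cases h : g b = v <;> by_cases h' : κ b = k <;> simp [h, h', revealing, hsum]
  have hmax : ∀ o, max (∑ b, if g b = true then L b o else 0)
      (∑ b, if g b = false then L b o else 0)
      = ∑ k, if ψ o = k then max (∑ b, if g b = true then L b o else 0)
      (∑ b, if g b = false then L b o else 0) else 0 := by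
    intro o; simp
  unfold guessValue
  rw [Finset.sum_congr rfl fun o _ => hmax o, Finset.sum_comm]
  refine Finset.sum_le_sum fun k _ => max_le ?_ ?_ <;> rw [key] <;>
    refine Finset.sum_le_sum fun o _ => ?_ <;> split_ifs <;> simp

/-- The likelihood, given the bits `b`, that agent `i` observes `o = (bᵢ, mᵢ, fᵢ)`. -/
def obsL {N : ℕ} (s : Profile N) (F : Protocol N) (i : Fin N) (b : Bits N)
    (o : Bool × Bool × Bits N) : ℝ :=
  if b i.succ = o.1 then
    ∑ m : Bits N, if m i.succ = o.2.1 then msgP s b m * (F s m o.2.2).toReal else 0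
  else 0

lemma pObs_eq_sum_obsL {N : ℕ} (g : Bits N → Bool) (s : Profile N) (F : Protocol N) (i : Fin N)
    (o : Bool × Bool × Bits N) (v : Bool) :
    pObs g s F i o.1 o.2.1 o.2.2 v
      = ((1 : ℝ) / 2) ^ (N + 1) * ∑ b, if g b = v then obsL s F i b o else 0 := by
  unfold pObs obsL jointP
  rw [Finset.mul_sum]
  refine Finset.sum_congr rfl fun b _ => ?_
  by_cases h1 : g b = v <;> by_cases h2 : b i.succ = o.1 <;>
    simp [h1, h2, Finset.mul_sum, mul_assoc]

lemma V_eq_guessValue {N : ℕ} (g : Bits N → Bool) (c : Fin N → ℝ) (s : Profile N)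
    (F : Protocol N) (i : Fin N) :
    V g c s F i = c i * (((1 : ℝ) / 2) ^ (N + 1) * guessValue g (obsL s F i)) := by
  have hmax : ∀ x y : ℝ, (if x > y then x else if y > x then y else (y + x) / 2) = max x y := by
    intro x y
    rcases lt_trichotomy x y with h | h | h
    · simp [h, h.le, not_lt.2 h.le]
    · simp [h]
    · simp [h, h.le]
  have hpos : (0 : ℝ) ≤ (1 / 2) ^ (N + 1) := by positivity
  unfold V guessValue
  simp_rw [hmax]
  congr 1
  rw [Finset.mul_sum, Fintype.sum_prod_type]
  refine Finset.sum_congr rfl fun bi _ => ?_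
  rw [Fintype.sum_prod_type]
  refine Finset.sum_congr rfl fun mi _ => Finset.sum_congr rfl fun f _ => ?_
  have h := pObs_eq_sum_obsL g s F i (bi, mi, f)
  rw [mul_max_of_nonneg _ _ hpos, ← h, ← h]

lemma strandP_nonneg (s : Strategy) (b m : Bool) : 0 ≤ strandP s b m := by
  have h1 := s.1.2
  have h2 := s.2.2
  rw [Set.mem_Icc] at h1 h2
  unfold strandP
  split_ifs <;> linarith

lemma sum_strandP (s : Strategy) (b : Bool) : ∑ m, strandP s b m = 1 := by
  simp [strandP]

lemma strandP_of_zeroInfo {s : Strategy} (h : ZeroInfo s) (b b' m : Bool) :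
    strandP s b m = strandP s b' m := by
  unfold ZeroInfo at h
  simp [strandP, h]

lemma msgP_nonneg {N : ℕ} (s : Profile N) (b m : Bits N) : 0 ≤ msgP s b m :=
  mul_nonneg (by split_ifs <;> norm_num) (Finset.prod_nonneg fun _ _ => strandP_nonneg _ _ _)

/-- Marginal of one coordinate under a product distribution. -/
lemma sum_prod_of_apply_eq {ι : Type*} [Fintype ι] [DecidableEq ι] (t : ι → Bool → ℝ)
    (ht : ∀ j, ∑ x, t j x = 1) (i : ι) (x : Bool) :
    (∑ m : ι → Bool, if m i = x then ∏ j, t j (m j) else 0) = t i x := by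
  have h1 : ∀ m : ι → Bool, (if m i = x then ∏ j, t j (m j) else 0)
      = ∏ j, (if j = i then (if m j = x then t j (m j) else 0) else t j (m j)) := by
    intro m
    split_ifs with h
    · refine Finset.prod_congr rfl fun j _ => ?_
      split_ifs with h1 h2 <;> simp_all
    · exact (Finset.prod_eq_zero (Finset.mem_univ i) (by simp [h])).symm
  simp_rw [h1]
  rw [← Fintype.prod_sum (fun j y => if j = i then (if y = x then t j y else 0) else t j y),
    Finset.prod_eq_single i]
  · simp
  · intro j _ hj
    simpa [hj] using ht j
  · simp

lemma sum_msgP_of_apply_eq {N : ℕ} (s : Profile N) (b : Bits N) (i : Fin N) (x : Bool) :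
    (∑ m : Bits N, if m i.succ = x then msgP s b m else 0) = strandP (s i) (b i.succ) x := by
  have := sum_prod_of_apply_eq
    (Fin.cons (fun y => if y = b 0 then (1 : ℝ) else 0)
      (fun j y => strandP (s j) (b j.succ) y) : Fin (N + 1) → Bool → ℝ)
    (by
      intro j
      refine Fin.cases ?_ (fun j => ?_) j
      · simp
      · simpa using sum_strandP (s j) (b j.succ)) i.succ x
  simpa [Fin.prod_univ_succ, msgP] using this

lemma sum_toReal_pmf {α : Type*} [Fintype α] (p : PMF α) : ∑ a, (p a).toReal = 1 := by
  rw [← ENNReal.toReal_sum fun a _ => p.apply_ne_top a, ← tsum_fintype (L := .unconditional _),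
    p.tsum_coe, ENNReal.toReal_one]

lemma obsL_nonneg {N : ℕ} (s : Profile N) (F : Protocol N) (i : Fin N) (b : Bits N)
    (o : Bool × Bool × Bits N) : 0 ≤ obsL s F i b o := by
  unfold obsL
  split_ifs
  · refine Finset.sum_nonneg fun m _ => ?_
    split_ifs
    · exact mul_nonneg (msgP_nonneg _ _ _) ENNReal.toReal_nonneg
    · rfl
  · rfl

lemma sum_obsL {N : ℕ} (s : Profile N) (F : Protocol N) (i : Fin N) (b : Bits N) :
    ∑ o, obsL s F i b o = 1 := by
  have h : ∀ mi : Bool, (∑ f, ∑ m : Bits N,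
      if m i.succ = mi then msgP s b m * (F s m f).toReal else 0)
      = strandP (s i) (b i.succ) mi := by
    intro mi
    rw [Finset.sum_comm, ← sum_msgP_of_apply_eq s b i mi]
    refine Finset.sum_congr rfl fun m _ => ?_
    split_ifs
    · rw [← Finset.mul_sum, sum_toReal_pmf, mul_one]
    · simp
  rw [Fintype.sum_prod_type, Finset.sum_eq_single (b i.succ)]
  · rw [Fintype.sum_prod_type, ← sum_strandP (s i) (b i.succ)]
    refine Finset.sum_congr rfl fun mi _ => ?_
    simpa [obsL] using h mi
  · intro x _ hx
    refine Finset.sum_eq_zero fun o _ => ?_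
    simp [obsL, Ne.symm hx]
  · simp

/-- Expected profit of an agent `i` who learns nothing but her own bit. -/
def baseProfit {N : ℕ} (g : Bits N → Bool) (c : Fin N → ℝ) (i : Fin N) : ℝ :=
  c i * (((1 : ℝ) / 2) ^ (N + 1) * guessValue g (revealing fun b : Bits N => b i.succ))

/-- Expected profit of an agent `i` who learns exactly her own bit and that of the center. -/
def centerProfit {N : ℕ} (g : Bits N → Bool) (c : Fin N → ℝ) (i : Fin N) : ℝ :=
  c i * (((1 : ℝ) / 2) ^ (N + 1) * guessValue g (revealing fun b : Bits N => (b i.succ, b 0)))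

section Profit

variable {N : ℕ} {g : Bits N → Bool} {c : Fin N → ℝ} {i : Fin N}

lemma profit_le_profit (hc : 0 < c i) {x y : ℝ} (h : x ≤ y) :
    c i * (((1 : ℝ) / 2) ^ (N + 1) * x) ≤ c i * (((1 : ℝ) / 2) ^ (N + 1) * y) := by
  gcongr

lemma baseProfit_le_V (hc : 0 < c i) (s : Profile N) (F : Protocol N) :
    baseProfit g c i ≤ V g c s F i := by
  rw [V_eq_guessValue]
  refine profit_le_profit hc (revealing_le_guessValue g _ (sum_obsL s F i) _ Prod.fst ?_)
  intro b o h
  by_contra hne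
  exact h (if_neg (Ne.symm hne))

lemma V_le_baseProfit (hc : 0 < c i) (s : Profile N) (F : Protocol N)
    (hF : ∀ m, F s m = PMF.uniformOfFintype (Bits N)) : V g c s F i ≤ baseProfit g c i := by
  rw [V_eq_guessValue]
  refine profit_le_profit hc (guessValue_le_revealing g _ (obsL_nonneg s F i) (sum_obsL s F i) _
    (fun x _ => x) fun b o => ?_)
  have h : ∀ b : Bits N, obsL s F i b o = if b i.succ = o.1 then
      strandP (s i) (b i.succ) o.2.1 * (PMF.uniformOfFintype (Bits N) o.2.2).toReal else 0 := by
    intro b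
    simp only [obsL, hF, ← sum_msgP_of_apply_eq, Finset.sum_mul, ite_mul, zero_mul]
  rw [h, h]

lemma V_le_centerProfit (hc : 0 < c i) (s : Profile N) (F : Protocol N)
    (hs : ∀ j, j ≠ i → ZeroInfo (s j)) : V g c s F i ≤ centerProfit g c i := by
  rw [V_eq_guessValue]
  refine profit_le_profit hc (guessValue_le_revealing g _ (obsL_nonneg s F i) (sum_obsL s F i) _
    (fun x => Fin.cons x.2 fun _ => x.1) fun b o => ?_)
  have h : ∀ m, msgP s b m = msgP s (Fin.cons (b 0) fun _ => b i.succ) m := by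
    intro m
    unfold msgP
    simp only [Fin.cons_zero, Fin.cons_succ]
    congr 1
    refine Finset.prod_congr rfl fun j _ => ?_
    by_cases hj : j = i
    · rw [hj]
    · exact strandP_of_zeroInfo (hs j hj) _ _ _
  simp only [obsL, h, Fin.cons_succ]

lemma centerProfit_le_V (hc : 0 < c i) (s : Profile N) (F : Protocol N)
    (hF : ∀ m, F s m = PMF.pure m) : centerProfit g c i ≤ V g c s F i := by
  rw [V_eq_guessValue]
  refine profit_le_profit hc (revealing_le_guessValue g _ (sum_obsL s F i) _
    (fun o => (o.1, o.2.2 0)) ?_)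
  intro b o h
  have h1 : b i.succ = o.1 := by
    by_contra hne
    exact h (if_neg hne)
  rw [obsL, if_pos h1] at h
  obtain ⟨m, -, hm⟩ := Finset.exists_ne_zero_of_sum_ne_zero h
  have hf : o.2.2 = m := by
    by_contra hne
    simp [hF, hne] at hm
  have h0 : m 0 = b 0 := by
    by_contra hne
    simp [msgP, hne] at hm
  simp [h1, hf, h0]

end Profit

/-- There are informative strategies of arbitrarily small price. -/
lemma exists_informative_lt (p : Strategy → ℝ) (hp : Continuous p)
    (h0 : ∀ s, ZeroInfo s → p s = 0) {ε : ℝ} (hε : 0 < ε) : ∃ s, ¬ ZeroInfo s ∧ p s < ε := by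
  let z : Set.Icc (0 : ℝ) 1 := ⟨0, by norm_num⟩
  let h : ℝ → ℝ := fun t => p (z, Set.projIcc 0 1 zero_le_one t)
  have hcont : Continuous h := by
    have := continuous_projIcc (h := zero_le_one (α := ℝ))
    fun_prop
  have hz : h 0 < ε := by
    have : h 0 = 0 := h0 _ (by simp [ZeroInfo, z, Set.projIcc])
    rwa [this]
  have h1 : ∀ᶠ t in nhdsWithin (0 : ℝ) (Set.Ioi 0), h t < ε :=
    (hcont.continuousAt.eventually_lt_const hz).filter_mono nhdsWithin_le_nhds
  obtain ⟨t, ht, ht'⟩ := (h1.and (Ioo_mem_nhdsGT (zero_lt_one (α := ℝ)))).exists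
  refine ⟨_, ?_, ht⟩
  rw [Set.projIcc_of_mem zero_le_one ⟨ht'.1.le, ht'.2.le⟩]
  exact ht'.1.ne

lemma not_zeroInfo_sT : ¬ ZeroInfo sT := by simp [ZeroInfo, sT]

/-- The center is only useful if some agent profits from learning the bit of the center. -/
lemma exists_baseProfit_lt_centerProfit {N : ℕ} {g : Bits N → Bool} {c : Fin N → ℝ}
    (hc : ∀ i, 0 < c i) {price : Fin N → Strategy → ℝ}
    (hprice0 : ∀ i s, ZeroInfo s → price i s = 0)
    (hpricePos : ∀ i s, ¬ ZeroInfo s → 0 < price i s) (hnh : ¬ Helpless N g c price) :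
    ∃ i, baseProfit g c i < centerProfit g c i := by
  unfold Helpless at hnh
  push Not at hnh
  obtain ⟨i, F, si, hsi, sr, hsr, hlt⟩ := hnh
  refine ⟨i, ?_⟩
  have h1 := baseProfit_le_V (g := g) (hc i) sr F
  have h2 := V_le_centerProfit (g := g) (hc i) (Function.update sr i si) (improve i F)
    (fun j hj => by simpa [hj] using hsr j)
  have h3 := hpricePos i si hsi
  have h4 := hprice0 i _ (hsr i)
  simp only [U, Function.update_self] at hlt
  linarith

section Competitive

variable {N : ℕ} {g : Bits N → Bool} {c : Fin N → ℝ} {price : Fin N → Strategy → ℝ}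
  {s : Profile N}

lemma Fc_of_priceR_lt {i : Fin N}
    (h : ∀ j, j ≠ i → priceR price j (s j) < priceR price i (s i)) (m : Bits N) :
    Fc price i s m = PMF.pure m := by
  simp only [Fc, if_pos h, ite_self]

/-- In an equilibrium, an agent who receives random bits plays a zero-information strategy. -/
lemma Equilibrium.zeroInfo_of_uniform (hc : ∀ i, 0 < c i)
    (hprice0 : ∀ i s, ZeroInfo s → price i s = 0)
    (hpricePos : ∀ i s, ¬ ZeroInfo s → 0 < price i s)
    (hs : Equilibrium g c price s (Fc price)) {i : Fin N}
    (hF : ∀ m, Fc price i s m = PMF.uniformOfFintype (Bits N)) : ZeroInfo (s i) := by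
  by_contra hne
  have h := hs i (sT.1, sT.1)
  have h1 := baseProfit_le_V (g := g) (hc i) (Function.update s i (sT.1, sT.1)) (Fc price i)
  have h2 := V_le_baseProfit (g := g) (hc i) s (Fc price i) hF
  have h3 := hpricePos i _ hne
  have h4 := hprice0 i (sT.1, sT.1) rfl
  simp only [U, Function.update_self] at h
  linarith

/-- If all other agents play zero-information strategies, agent `i` can secure almost the profit
of learning the bit of the center. -/
lemma Equilibrium.centerProfit_sub_le_U (hc : ∀ i, 0 < c i)
    (hprice0 : ∀ i s, ZeroInfo s → price i s = 0)
    (hpricePos : ∀ i s, ¬ ZeroInfo s → 0 < price i s)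
    (hs : Equilibrium g c price s (Fc price)) {i : Fin N} (h0 : ∀ j, j ≠ i → ZeroInfo (s j))
    {s' : Strategy} (hs' : ¬ ZeroInfo s') :
    centerProfit g c i - price i s' ≤ U g c price s (Fc price i) i := by
  have h1 := centerProfit_le_V (g := g) (hc i) (Function.update s i s') (Fc price i)
    (Fc_of_priceR_lt fun j hj => by
      rw [Function.update_of_ne hj, Function.update_self, priceR, hprice0 j _ (h0 j hj), zero_div]
      exact div_pos (hpricePos i _ hs') (hpricePos i _ not_zeroInfo_sT))
  have h := hs i s'
  simp only [U, Function.update_self] at h ⊢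
  linarith

end Competitive

/-- Uniqueness Theorem. -/
theorem uniqueness_theorem (N : ℕ) (hN : 2 ≤ N) (g : Bits N → Bool) (c : Fin N → ℝ)
    (hc : ∀ i, 0 < c i)
    (price : Fin N → Strategy → ℝ)
    (hpriceCont : ∀ i, Continuous (price i))
    (hprice0 : ∀ i s, ZeroInfo s → price i s = 0)
    (hpricePos : ∀ i s, ¬ ZeroInfo s → 0 < price i s)
    (hpriceMax : ∀ i s, price i s ≤ price i sT)
    (hnh : ¬ Helpless N g c price)
    (ht : Equilibrium g c price (truthProfile N) (Fc price)) :
    ∀ s : Profile N, Equilibrium g c price s (Fc price) → s = truthProfile N := by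
  intro s hs
  by_contra hne
  have hnt : ¬ ∀ j, s j = sT := fun h => hne (funext h)
  have hlose : ∀ i, ¬ (∀ j, j ≠ i → priceR price j (s j) < priceR price i (s i)) →
      ∀ m, Fc price i s m = PMF.uniformOfFintype (Bits N) := by
    intro i hi m
    simp only [Fc, if_neg hnt, if_neg hi]
  have hzero : ∀ i, ¬ (∀ j, j ≠ i → priceR price j (s j) < priceR price i (s i)) →
      ZeroInfo (s i) :=
    fun i hi => hs.zeroInfo_of_uniform hc hprice0 hpricePos (hlose i hi)
  by_cases hall : ∀ j, ZeroInfo (s j)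
  · obtain ⟨i, hi⟩ := exists_baseProfit_lt_centerProfit hc hprice0 hpricePos hnh
    have : Nontrivial (Fin N) := Fin.nontrivial_iff_two_le.2 hN
    have hnw : ¬ (∀ j, j ≠ i → priceR price j (s j) < priceR price i (s i)) := by
      intro h
      obtain ⟨j, hj⟩ := exists_ne i
      have := h j hj
      simp [priceR, hprice0 _ _ (hall _)] at this
    obtain ⟨s', hs', hlt⟩ := exists_informative_lt (price i) (hpriceCont i) (hprice0 i)
      (sub_pos.2 hi)
    have h1 := hs.centerProfit_sub_le_U (i := i) hc hprice0 hpricePos (fun j _ => hall j) hs'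
    have h2 := V_le_baseProfit (g := g) (hc i) s (Fc price i) (hlose i hnw)
    have h3 := hprice0 i _ (hall i)
    simp only [U] at h1
    linarith
  · push Not at hall
    obtain ⟨i, hi⟩ := hall
    have hwin : ∀ j, j ≠ i → priceR price j (s j) < priceR price i (s i) := by
      by_contra h
      exact hi (hzero i h)
    have hother : ∀ j, j ≠ i → ZeroInfo (s j) := fun j hj =>
      hzero j fun h => lt_asymm (hwin j hj) (h i hj.symm)
    obtain ⟨s', hs', hlt⟩ := exists_informative_lt (price i) (hpriceCont i) (hprice0 i)
      (hpricePos i _ hi)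
    have h1 := hs.centerProfit_sub_le_U hc hprice0 hpricePos hother hs'
    have h2 := V_le_centerProfit (g := g) (hc i) s (Fc price i) hother
    simp only [U] at h1
    linarith

end
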